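/- Suppose n ≥ 3 and n ≡ 2 (mod 4). Let T : {1,…,n} → Cl_n be such that T_a ∈ W for every a. Then the equations Σ_{a=1}^{n} [ T_a , e_a e_b ] = 0 (for every b ∈ {1,…,n}, where [x,y] = xy − yx) hold if and only if there exist scalars φ_1,…,φ_n ∈ ℂ such that T_a = φ_a · (e_1 e_2 ⋯ e_n) for every a, i.e. each T_a is a scalar multiple of the volume element of the Clifford algebra. (This is the extra, purely spinorial freedom in the connection which arises in dimensions n ≡ 2 mod 4 and must be removed by hand to recover Einstein–Hilbert gravity.) -/

import Mathlib

open scoped BigOperators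

/-- The quadratic form `Q(x) = −(x_1² + ⋯ + x_n²)` on `ℂ^n`. -/
noncomputable def negSumSq (n : ℕ) : QuadraticForm ℂ (Fin n → ℂ) :=
  QuadraticMap.weightedSumSquares ℂ (fun _ : Fin n => (-1 : ℂ))

/-- The generators `e_a` of the Clifford algebra `Cl_n`, satisfying
`e_a e_b + e_b e_a = −2 δ_{ab}`. -/
noncomputable def gen {n : ℕ} (a : Fin n) : CliffordAlgebra (negSumSq n) :=
  CliffordAlgebra.ι (negSumSq n) (Pi.single a 1)

/-- For a subset `S = {s_1 < ⋯ < s_k}`, the product `e_S = e_{s_1} ⋯ e_{s_k}`. -/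
noncomputable def genProd {n : ℕ} (S : Finset (Fin n)) : CliffordAlgebra (negSumSq n) :=
  ((S.sort (· ≤ ·)).map gen).prod

/-- The span `W` of the products `e_S` over subsets `S` with `|S| ≡ 2 (mod 4)`. -/
noncomputable def spanW (n : ℕ) : Submodule ℂ (CliffordAlgebra (negSumSq n)) :=
  Submodule.span ℂ {x | ∃ S : Finset (Fin n), S.card % 4 = 2 ∧ x = genProd S}

open CliffordAlgebra

theorem negSumSq_single {n : ℕ} (a : Fin n) : negSumSq n (Pi.single a 1) = -1 := by
  simp [negSumSq, QuadraticMap.weightedSumSquares_apply, Pi.single_apply]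

theorem gen_mul_self {n : ℕ} (a : Fin n) : gen a * gen a = -1 := by
  rw [gen, ι_sq_scalar, negSumSq_single, map_neg, map_one]

theorem gen_mul_gen_of_ne {n : ℕ} {a b : Fin n} (h : a ≠ b) :
    gen a * gen b = -(gen b * gen a) := by
  rw [eq_neg_iff_add_eq_zero, gen, gen, ι_mul_ι_add_swap]
  have : QuadraticMap.polar (negSumSq n) (Pi.single a 1) (Pi.single b 1) = 0 := by
    simp only [QuadraticMap.polar, negSumSq_single]
    simp only [negSumSq, QuadraticMap.weightedSumSquares_apply, Pi.add_apply, Pi.single_apply]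
    have (i : Fin n) : (-1 : ℂ) • (((if i = a then (1 : ℂ) else 0) + if i = b then 1 else 0) *
        ((if i = a then 1 else 0) + if i = b then 1 else 0)) =
        (if i = a then -1 else 0) + if i = b then -1 else 0 := by
      by_cases ha : i = a <;> by_cases hb : i = b <;> simp_all
    simp only [this, Finset.sum_add_distrib]
    simp
  rw [this, map_zero]

theorem exists_smul_prod_map_gen_of_perm {n : ℕ} {l l' : List (Fin n)} (h : l.Perm l') :
    ∃ c : ℂ, (l.map gen).prod = c • (l'.map gen).prod := by
  induction h with
  | nil => exact ⟨1, by simp⟩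
  | cons a _ ih =>
    obtain ⟨c, hc⟩ := ih
    exact ⟨c, by simp [hc]⟩
  | swap a b l =>
    by_cases h : a = b
    · exact ⟨1, by simp [h]⟩
    · refine ⟨-1, ?_⟩
      simp only [List.map_cons, List.prod_cons, ← mul_assoc, gen_mul_gen_of_ne h]
      simp
  | trans _ _ ih₁ ih₂ =>
    obtain ⟨c, hc⟩ := ih₁
    obtain ⟨d, hd⟩ := ih₂
    exact ⟨c * d, by rw [hc, hd, smul_smul]⟩

theorem gen_mul_prod_map_gen {n : ℕ} {a : Fin n} {l : List (Fin n)} (h : a ∉ l) :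
    gen a * (l.map gen).prod = (-1 : ℂ) ^ l.length • ((l.map gen).prod * gen a) := by
  induction l with
  | nil => simp
  | cons b l ih =>
    rw [List.mem_cons, not_or] at h
    rw [List.map_cons, List.prod_cons, ← mul_assoc, gen_mul_gen_of_ne h.1, neg_mul, mul_assoc,
      ih h.2, List.length_cons, pow_succ, mul_smul_comm, mul_assoc]
    simp

theorem gen_mul_genProd_of_notMem {n : ℕ} {a : Fin n} {S : Finset (Fin n)} (h : a ∉ S) :
    gen a * genProd S = (-1 : ℂ) ^ S.card • (genProd S * gen a) := by
  have := gen_mul_prod_map_gen (a := a) (l := S.sort (· ≤ ·)) (by simpa using h)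
  rwa [Finset.length_sort] at this

theorem exists_genProd_eq_smul_gen_mul {n : ℕ} {a : Fin n} {S : Finset (Fin n)} (h : a ∈ S) :
    ∃ c : ℂ, genProd S = c • (gen a * genProd (S.erase a)) := by
  have hp : (S.sort (· ≤ ·)).Perm (a :: (S.erase a).sort (· ≤ ·)) := by
    rw [← Multiset.coe_eq_coe, ← Multiset.cons_coe, Finset.sort_eq, Finset.sort_eq,
      Finset.erase_val, Multiset.cons_erase h]
  obtain ⟨c, hc⟩ := exists_smul_prod_map_gen_of_perm hp
  exact ⟨c, by simpa [genProd] using hc⟩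

theorem exists_gen_mul_genProd_insert {n : ℕ} {a : Fin n} {S : Finset (Fin n)} (h : a ∉ S) :
    ∃ c : ℂ, gen a * genProd S = c • genProd (insert a S) := by
  have hp : (a :: S.sort (· ≤ ·)).Perm ((insert a S).sort (· ≤ ·)) := by
    rw [← Multiset.coe_eq_coe, ← Multiset.cons_coe, Finset.sort_eq, Finset.sort_eq,
      Finset.insert_val_of_notMem h]
  obtain ⟨c, hc⟩ := exists_smul_prod_map_gen_of_perm hp
  exact ⟨c, by simpa [genProd] using hc⟩

theorem exists_gen_mul_genProd_erase {n : ℕ} {a : Fin n} {S : Finset (Fin n)} (h : a ∈ S) :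
    ∃ c : ℂ, gen a * genProd S = c • genProd (S.erase a) := by
  obtain ⟨c, hc⟩ := exists_genProd_eq_smul_gen_mul h
  exact ⟨-c, by rw [hc, mul_smul_comm, ← mul_assoc, gen_mul_self]; simp⟩

theorem gen_mul_genProd_of_mem {n : ℕ} {a : Fin n} {S : Finset (Fin n)} (h : a ∈ S) :
    gen a * genProd S = -((-1 : ℂ) ^ S.card • (genProd S * gen a)) := by
  obtain ⟨c, hc⟩ := exists_genProd_eq_smul_gen_mul h
  have hcomm := gen_mul_genProd_of_notMem (Finset.notMem_erase a S)
  rw [← Finset.card_erase_add_one h, pow_succ, hc, mul_smul_comm, smul_mul_assoc,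
    mul_assoc (gen a) _ (gen a), hcomm]
  simp only [mul_smul_comm]
  simp [smul_comm c]

/-- The span of the products `e_S` over subsets `S` whose size satisfies `p`. -/
noncomputable def spanCard (n : ℕ) (p : ℕ → Prop) :
    Submodule ℂ (CliffordAlgebra (negSumSq n)) :=
  Submodule.span ℂ {x | ∃ S : Finset (Fin n), p S.card ∧ x = genProd S}

theorem genProd_mem_spanCard {n : ℕ} {p : ℕ → Prop} {S : Finset (Fin n)} (h : p S.card) :
    genProd S ∈ spanCard n p :=
  Submodule.subset_span ⟨S, h, rfl⟩

/-- The operator `x ↦ ∑ a, e_a x e_a`. -/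
noncomputable def genSandwich (n : ℕ) : Module.End ℂ (CliffordAlgebra (negSumSq n)) :=
  ∑ a : Fin n, LinearMap.mulLeft ℂ (gen a) ∘ₗ LinearMap.mulRight ℂ (gen a)

theorem genSandwich_apply {n : ℕ} (x : CliffordAlgebra (negSumSq n)) :
    genSandwich n x = ∑ a : Fin n, gen a * (x * gen a) := by
  simp [genSandwich, LinearMap.sum_apply]

theorem genSandwich_genProd {n : ℕ} {S : Finset (Fin n)} (hS : Odd S.card) :
    genSandwich n (genProd S) = ((n : ℂ) - 2 * S.card) • genProd S := by
  have key (a : Fin n) : gen a * (genProd S * gen a) =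
      ((1 : ℂ) - 2 * if a ∈ S then 1 else 0) • genProd S := by
    rw [← mul_assoc]
    by_cases h : a ∈ S
    · rw [gen_mul_genProd_of_mem h, hS.neg_one_pow]
      simp only [neg_smul, one_smul, neg_neg, mul_assoc, gen_mul_self, h, if_true]
      norm_num
    · rw [gen_mul_genProd_of_notMem h, hS.neg_one_pow]
      simp [mul_assoc, gen_mul_self, h]
  rw [genSandwich_apply, Finset.sum_congr rfl fun a _ => key a, ← Finset.sum_smul,
    Finset.sum_sub_distrib, ← Finset.mul_sum]
  simp

theorem eq_zero_of_genSandwich_eq_smul {n : ℕ} {p : ℕ → Prop} {μ : ℂ}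
    (hp : ∀ k, p k → Odd k ∧ (n : ℂ) - 2 * k ≠ μ) {x : CliffordAlgebra (negSumSq n)}
    (hx : x ∈ spanCard n p) (hμ : genSandwich n x = μ • x) : x = 0 := by
  have hdisj := (Module.End.eigenspaces_iSupIndep (genSandwich n)) μ
  refine (Submodule.disjoint_def.mp hdisj) x (Module.End.mem_eigenspace_iff.mpr hμ) ?_
  refine (Submodule.span_le.mpr ?_ : spanCard n p ≤ _) hx
  rintro _ ⟨S, hS, rfl⟩
  exact Submodule.mem_iSup_of_mem _ (Submodule.mem_iSup_of_mem (hp _ hS).2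
    (Module.End.mem_eigenspace_iff.mpr (genSandwich_genProd (hp _ hS).1)))

theorem mul_gen_add_gen_mul_mem {n : ℕ} {x : CliffordAlgebra (negSumSq n)} (hx : x ∈ spanW n)
    (a : Fin n) : x * gen a + gen a * x ∈ spanCard n (fun k => k % 4 = 3) := by
  induction hx using Submodule.span_induction with
  | mem x hx =>
    obtain ⟨S, hS, rfl⟩ := hx
    have he : Even S.card := Nat.even_iff.mpr (by omega)
    by_cases h : a ∈ S
    · simp [gen_mul_genProd_of_mem h, he.neg_one_pow]
    · have hc := gen_mul_genProd_of_notMem h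
      rw [he.neg_one_pow, one_smul] at hc
      obtain ⟨c, hi⟩ := exists_gen_mul_genProd_insert h
      rw [← hc, hi]
      have : genProd (insert a S) ∈ spanCard n (fun k => k % 4 = 3) :=
        genProd_mem_spanCard (by rw [Finset.card_insert_of_notMem h]; omega)
      exact add_mem (Submodule.smul_mem _ _ this) (Submodule.smul_mem _ _ this)
  | zero => simp
  | add x y _ _ hx hy =>
    convert add_mem hx hy using 1
    noncomm_ring
  | smul c x _ hx =>
    rw [smul_mul_assoc, mul_smul_comm, ← smul_add]
    exact Submodule.smul_mem _ c hx

theorem mul_gen_sub_gen_mul_mem {n : ℕ} {x : CliffordAlgebra (negSumSq n)} (hx : x ∈ spanW n)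
    (a : Fin n) : x * gen a - gen a * x ∈ spanCard n Odd := by
  induction hx using Submodule.span_induction with
  | mem x hx =>
    obtain ⟨S, hS, rfl⟩ := hx
    have he : Even S.card := Nat.even_iff.mpr (by omega)
    by_cases h : a ∈ S
    · have hc := gen_mul_genProd_of_mem h
      rw [he.neg_one_pow, one_smul, eq_comm, neg_eq_iff_eq_neg] at hc
      obtain ⟨c, hi⟩ := exists_gen_mul_genProd_erase h
      rw [hc, hi]
      have : genProd (S.erase a) ∈ spanCard n Odd :=
        genProd_mem_spanCard (by rw [Finset.card_erase_of_mem h, Nat.odd_iff]; omega)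
      exact sub_mem (neg_mem (Submodule.smul_mem _ _ this)) (Submodule.smul_mem _ _ this)
    · simp [gen_mul_genProd_of_notMem h, he.neg_one_pow]
  | zero => simp
  | add x y _ _ hx hy =>
    convert add_mem hx hy using 1
    noncomm_ring
  | smul c x _ hx =>
    rw [smul_mul_assoc, mul_smul_comm, ← smul_sub]
    exact Submodule.smul_mem _ c hx

theorem mem_spanCard_of_genSandwich_eq_smul {n : ℕ} {x : CliffordAlgebra (negSumSq n)}
    (hx : x ∈ spanCard n Odd) (hμ : genSandwich n x = (2 - n : ℂ) • x) :
    x ∈ spanCard n (fun k => Odd k ∧ k + 1 = n) := by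
  have hle : spanCard n Odd ≤
      spanCard n (fun k => Odd k ∧ k + 1 = n) ⊔ spanCard n (fun k => Odd k ∧ k + 1 ≠ n) := by
    refine Submodule.span_le.mpr ?_
    rintro _ ⟨S, hS, rfl⟩
    by_cases h : S.card + 1 = n
    · exact Submodule.mem_sup_left (genProd_mem_spanCard ⟨hS, h⟩)
    · exact Submodule.mem_sup_right (genProd_mem_spanCard ⟨hS, h⟩)
  obtain ⟨y, hy, z, hz, rfl⟩ := Submodule.mem_sup.mp (hle hx)
  have hLy : genSandwich n y = (2 - n : ℂ) • y := by
    have hle' : spanCard n (fun k => Odd k ∧ k + 1 = n) ≤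
        Module.End.eigenspace (genSandwich n) (2 - n : ℂ) := by
      refine Submodule.span_le.mpr ?_
      rintro _ ⟨S, ⟨hS, h⟩, rfl⟩
      rw [SetLike.mem_coe, Module.End.mem_eigenspace_iff, genSandwich_genProd hS]
      congr 1
      have : (n : ℂ) = S.card + 1 := by exact_mod_cast h.symm
      rw [this]
      ring
    exact Module.End.mem_eigenspace_iff.mp (hle' hy)
  have hz0 : z = 0 := by
    refine eq_zero_of_genSandwich_eq_smul (μ := (2 - n : ℂ)) ?_ hz ?_
    · rintro k ⟨hk, hkn⟩
      refine ⟨hk, fun h => hkn ?_⟩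
      have : (k : ℂ) + 1 = n := by linear_combination (-1 / 2 : ℂ) * h
      exact_mod_cast this
    · rw [map_add, hLy, smul_add] at hμ
      exact add_left_cancel hμ
  rwa [hz0, add_zero]

theorem exists_mul_gen_sub_gen_mul_eq_smul {n : ℕ} {x : CliffordAlgebra (negSumSq n)}
    (hx : x ∈ spanCard n (fun k => Odd k ∧ k + 1 = n)) (b : Fin n) :
    ∃ c : ℂ, x * gen b - gen b * x = c • genProd (Finset.univ : Finset (Fin n)) := by
  induction hx using Submodule.span_induction with
  | mem x hx =>
    obtain ⟨S, ⟨ho, hS⟩, rfl⟩ := hx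
    by_cases h : b ∈ S
    · exact ⟨0, by simp [gen_mul_genProd_of_mem h, ho.neg_one_pow]⟩
    · have hc := gen_mul_genProd_of_notMem h
      rw [ho.neg_one_pow, neg_smul, one_smul, eq_comm, neg_eq_iff_eq_neg] at hc
      obtain ⟨c, hi⟩ := exists_gen_mul_genProd_insert h
      have hu : insert b S = Finset.univ := by
        rw [← Finset.card_eq_iff_eq_univ, Finset.card_insert_of_notMem h, hS, Fintype.card_fin]
      refine ⟨-c - c, ?_⟩
      rw [hc, hi, hu, sub_smul, neg_smul]
  | zero => exact ⟨0, by simp⟩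
  | add x y _ _ hx hy =>
    obtain ⟨c, hc⟩ := hx
    obtain ⟨d, hd⟩ := hy
    refine ⟨c + d, ?_⟩
    rw [add_smul, ← hc, ← hd]
    noncomm_ring
  | smul r x _ hx =>
    obtain ⟨c, hc⟩ := hx
    exact ⟨r * c, by rw [smul_mul_assoc, mul_smul_comm, ← smul_sub, hc, smul_smul]⟩

theorem two_smul_eq_of_sum_commutator_eq_zero {n : ℕ} {T : Fin n → CliffordAlgebra (negSumSq n)}
    {b : Fin n} (h : ∑ a : Fin n, (T a * (gen a * gen b) - (gen a * gen b) * T a) = 0) :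
    (2 : ℂ) • T b = -((∑ a, T a * gen a) * gen b + gen b * ∑ a, gen a * T a) := by
  have key (a : Fin n) : T a * (gen a * gen b) - (gen a * gen b) * T a =
      T a * gen a * gen b + gen b * (gen a * T a) + if a = b then (2 : ℂ) • T a else 0 := by
    split_ifs with hab
    · subst hab
      simp only [mul_assoc, gen_mul_self, ← mul_assoc (gen a) (gen a) (T a)]
      rw [two_smul]
      noncomm_ring
    · rw [gen_mul_gen_of_ne hab]
      have : T a * gen a * gen b = T a * (gen a * gen b) := mul_assoc _ _ _
      rw [this, gen_mul_gen_of_ne hab]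
      noncomm_ring
  rw [Finset.sum_congr rfl fun a _ => key a, Finset.sum_add_distrib, Finset.sum_add_distrib,
    ← Finset.sum_mul, ← Finset.mul_sum, Finset.sum_ite_eq' Finset.univ b] at h
  simp only [Finset.mem_univ, if_true] at h
  rw [eq_neg_iff_add_eq_zero, add_comm]
  exact h

theorem commute_genProd_univ {n : ℕ} (hn : Even n) (a b : Fin n) :
    genProd (Finset.univ : Finset (Fin n)) * (gen a * gen b) =
      (gen a * gen b) * genProd (Finset.univ : Finset (Fin n)) := by
  have hc (c : Fin n) := gen_mul_genProd_of_mem (Finset.mem_univ c)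
  simp only [Finset.card_univ, Fintype.card_fin, hn.neg_one_pow, one_smul] at hc
  rw [mul_assoc, hc b, mul_neg, ← mul_assoc (gen a), hc a, neg_mul, neg_neg, mul_assoc]

/-- In dimensions `n ≡ 2 (mod 4)`, a `T` with each `T_a` of Clifford order
`≡ 2 (mod 4)` satisfies `Σ_a [T_a, e_a e_b] = 0` for all `b` if and only if every
`T_a` is a scalar multiple of the volume element `e_1 e_2 ⋯ e_n`. -/
theorem stmt7 {n : ℕ} (hn : 3 ≤ n) (hmod : n % 4 = 2)
    (T : Fin n → CliffordAlgebra (negSumSq n))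
    (hT : ∀ a, T a ∈ spanW n) :
    (∀ b : Fin n,
      ∑ a : Fin n, (T a * (gen a * gen b) - (gen a * gen b) * T a) = 0)
    ↔ ∃ φ : Fin n → ℂ, ∀ a, T a = φ a • genProd (Finset.univ : Finset (Fin n)) := by
  have hev : Even n := Nat.even_iff.mpr (by omega)
  constructor
  · intro h
    set X := ∑ a, T a * gen a with hX
    set Y := ∑ a, gen a * T a with hY
    have hT2 (b : Fin n) : (2 : ℂ) • T b = -(X * gen b + gen b * Y) :=
      two_smul_eq_of_sum_commutator_eq_zero (h b)
    have hLY : genSandwich n Y = (n : ℂ) • X - (2 : ℂ) • X := by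
      have h1 : (2 : ℂ) • X = ∑ a, (X - gen a * (Y * gen a)) := by
        rw [hX, Finset.smul_sum]
        refine Finset.sum_congr rfl fun a _ => ?_
        rw [← smul_mul_assoc, hT2, neg_mul, add_mul, mul_assoc X, gen_mul_self]
        noncomm_ring
      rw [Finset.sum_sub_distrib, ← genSandwich_apply] at h1
      simp only [Finset.sum_const, Finset.card_univ, Fintype.card_fin] at h1
      rw [h1, Nat.cast_smul_eq_nsmul]
      abel
    have hLX : genSandwich n X = (n : ℂ) • Y - (2 : ℂ) • Y := by
      have h1 : (2 : ℂ) • Y = ∑ a, (Y - gen a * (X * gen a)) := by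
        rw [hY, Finset.smul_sum]
        refine Finset.sum_congr rfl fun a _ => ?_
        rw [← mul_smul_comm, hT2, mul_neg, mul_add, ← mul_assoc (gen a) (gen a), gen_mul_self]
        noncomm_ring
      rw [Finset.sum_sub_distrib, ← genSandwich_apply] at h1
      simp only [Finset.sum_const, Finset.card_univ, Fintype.card_fin] at h1
      rw [h1, Nat.cast_smul_eq_nsmul]
      abel
    have hadd : X + Y = 0 := by
      refine eq_zero_of_genSandwich_eq_smul (p := fun k => k % 4 = 3) (μ := (n : ℂ) - 2) ?_ ?_ ?_
      · refine fun k hk => ⟨Nat.odd_iff.mpr (by omega), fun he => ?_⟩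
        have : (k : ℂ) = 1 := by linear_combination (-1 / 2 : ℂ) * he
        have : k = 1 := by exact_mod_cast this
        omega
      · rw [hX, hY, ← Finset.sum_add_distrib]
        exact Submodule.sum_mem _ fun a _ => mul_gen_add_gen_mul_mem (hT a) a
      · rw [map_add, hLX, hLY]
        module
    have hsub : X - Y ∈ spanCard n (fun k => Odd k ∧ k + 1 = n) := by
      refine mem_spanCard_of_genSandwich_eq_smul ?_ ?_
      · rw [hX, hY, ← Finset.sum_sub_distrib]
        exact Submodule.sum_mem _ fun a _ => mul_gen_sub_gen_mul_mem (hT a) a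
      · rw [map_sub, hLX, hLY]
        module
    have hT4 (b : Fin n) : ∃ c : ℂ, T b = c • genProd (Finset.univ : Finset (Fin n)) := by
      obtain ⟨c, hc⟩ := exists_mul_gen_sub_gen_mul_eq_smul hsub b
      refine ⟨-(1 / 4) * c, ?_⟩
      have hYX : Y = -X := (neg_eq_of_add_eq_zero_right hadd).symm
      have h2 := hT2 b
      rw [hYX] at h2 hc
      rw [mul_smul, ← hc]
      have h3 : T b = (1 / 2 : ℂ) • (2 : ℂ) • T b := by rw [smul_smul]; norm_num
      rw [h3, h2]
      simp only [sub_neg_eq_add, add_mul, mul_add, mul_neg]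
      module
    choose φ hφ using hT4
    exact ⟨φ, hφ⟩
  · rintro ⟨φ, hφ⟩ b
    refine Finset.sum_eq_zero fun a _ => ?_
    rw [hφ, smul_mul_assoc, mul_smul_comm, commute_genProd_univ hev, sub_self]
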